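/- arXiv:0812.0820 — 2 statements merged into one kernel-verified Lean document; each statement's English description precedes it below -/
import Mathlib

section
/- Under the full expected growth condition and the lower-rate condition, let α ∈ (0,δ), let (u^m)_{m≥1} be a sequence of ordinary feedback selectors, and let (q_m) be a sequence of measurable functions E → [0,∞] with q_0 ≡ 0 and, for all m ∈ ℕ and x ∈ E, q_{m+1}(x) = L_α f(x,u^{m+1}_φ(x)) + H_α r(x,u^{m+1}_φ(x)) + G_α q_m(x,u^{m+1}_φ(x)). Then for every m ∈ ℕ and x ∈ E: q_m(x) ≤ (M/(c+α))·g(x) + Mb/(cα). -/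
open MeasureTheory ENNReal Set Filter Topology

namespace PDMP

noncomputable section

/-- Data of a controlled PDMP: state space `E ⊆ ℝⁿ`, flow `φ`, feasible action sets `feas = 𝕌`,
jump rate `lam = λ` and transition kernel `Q`. -/
structure Setting (n : ℕ) (U : Type*) [MeasurableSpace U] where
  E : Set (Fin n → ℝ)
  φ : (Fin n → ℝ) → ℝ → (Fin n → ℝ)
  feas : (Fin n → ℝ) → Set U
  lam : (Fin n → ℝ) → U → ℝ
  Q : (Fin n → ℝ) → U → Measure (Fin n → ℝ)

/-- A relaxed control: a time component (measures on the action space along the flow) and a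
boundary component. -/
structure RControl (U : Type*) [MeasurableSpace U] where
  time : ℝ → Measure U
  bdry : Measure U

variable {n : ℕ} {U : Type*} [MeasurableSpace U]

namespace Setting

variable (S : Setting n U)

/-- The exit time `t*(x)` from `E`, valued in `[0,∞]` (`∞` if the flow never reaches `∂E`). -/
def ts (x : Fin n → ℝ) : ℝ≥0∞ :=
  sInf {T : ℝ≥0∞ | ∃ t : ℝ, 0 < t ∧ S.φ x t ∈ frontier S.E ∧ T = ENNReal.ofReal t}

/-- Real version of the exit time (junk value `0` when `t*(x) = ∞`). -/
def tsR (x : Fin n → ℝ) : ℝ := (S.ts x).toReal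

/-- The time interval `[0, t*(x))` as a subset of `ℝ`. -/
def fs (x : Fin n → ℝ) : Set ℝ := {t : ℝ | 0 ≤ t ∧ ENNReal.ofReal t < S.ts x}

/-- `λ(y,μ) = ∫ λ(y,u) μ(du)`, as an extended nonnegative real. -/
def lamMix (y : Fin n → ℝ) (m : Measure U) : ℝ≥0∞ := ∫⁻ u, ENNReal.ofReal (S.lam y u) ∂m

/-- `Q k (y,a) = ∫_E k(z) Q(y,a;dz)`. -/
def Qpt (k : (Fin n → ℝ) → ℝ≥0∞) (y : Fin n → ℝ) (a : U) : ℝ≥0∞ := ∫⁻ z in S.E, k z ∂(S.Q y a)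

/-- `Q k (y,μ) = ∫∫_E k(z) Q(y,u;dz) μ(du)`. -/
def QMix (k : (Fin n → ℝ) → ℝ≥0∞) (y : Fin n → ℝ) (m : Measure U) : ℝ≥0∞ :=
  ∫⁻ u, S.Qpt k y u ∂m

/-- `λQ k (y,μ) = ∫ λ(y,u) ∫_E k(z) Q(y,u;dz) μ(du)`. -/
def lamQMix (k : (Fin n → ℝ) → ℝ≥0∞) (y : Fin n → ℝ) (m : Measure U) : ℝ≥0∞ :=
  ∫⁻ u, ENNReal.ofReal (S.lam y u) * S.Qpt k y u ∂m

/-- `Λ^μ(x,t) = ∫_0^t λ(φ(x,s), μ(s)) ds`. -/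
def Lam (x : Fin n → ℝ) (Θ : RControl U) (t : ℝ) : ℝ≥0∞ :=
  ∫⁻ s in Set.Ioc (0 : ℝ) t, S.lamMix (S.φ x s) (Θ.time s)

/-- The integrating factor `e^{-α t - Λ^μ(x,t)}` (equal to `0` when `Λ^μ(x,t) = ∞`). -/
def weight (α : ℝ) (x : Fin n → ℝ) (Θ : RControl U) (t : ℝ) : ℝ≥0∞ :=
  if S.Lam x Θ t = ⊤ then 0 else ENNReal.ofReal (Real.exp (-(α * t) - (S.Lam x Θ t).toReal))

/-- `𝓛_α(x,Θ) = ∫_0^{t*(x)} e^{-α s - Λ^μ(x,s)} ds`. -/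
def curlyL (α : ℝ) (x : Fin n → ℝ) (Θ : RControl U) : ℝ≥0∞ :=
  ∫⁻ t in S.fs x, S.weight α x Θ t

/-- `L_α v(x,Θ) = ∫_0^{t*(x)} e^{-α s - Λ^μ(x,s)} v(φ(x,s), μ(s)) ds`. -/
def Lop (α : ℝ) (v : (Fin n → ℝ) → Measure U → ℝ≥0∞) (x : Fin n → ℝ) (Θ : RControl U) :
    ℝ≥0∞ :=
  ∫⁻ t in S.fs x, S.weight α x Θ t * v (S.φ x t) (Θ.time t)

/-- `H_α w(x,Θ) = e^{-α t*(x) - Λ^μ(x,t*(x))} w(φ(x,t*(x)), μ∂)` when `t*(x) < ∞`, else `0`. -/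
def Hop (α : ℝ) (p : (Fin n → ℝ) → Measure U → ℝ≥0∞) (x : Fin n → ℝ) (Θ : RControl U) :
    ℝ≥0∞ :=
  if S.ts x < ⊤ then S.weight α x Θ (S.tsR x) * p (S.φ x (S.tsR x)) Θ.bdry else 0

/-- `G_α k(x,Θ)` for nonnegative `k`. -/
def Gop (α : ℝ) (k : (Fin n → ℝ) → ℝ≥0∞) (x : Fin n → ℝ) (Θ : RControl U) : ℝ≥0∞ :=
  S.Lop α (fun y m => S.lamQMix k y m) x Θ + S.Hop α (fun y m => S.QMix k y m) x Θ

/-- `G_α h(x,Θ)` for signed `h`, as `G_α h⁺ - G_α h⁻` in the extended reals. -/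
def GopS (α : ℝ) (h : (Fin n → ℝ) → ℝ) (x : Fin n → ℝ) (Θ : RControl U) : EReal :=
  ((S.Gop α (fun z => ENNReal.ofReal (h z)) x Θ : ℝ≥0∞) : EReal)
    - ((S.Gop α (fun z => ENNReal.ofReal (-h z)) x Θ : ℝ≥0∞) : EReal)

/-- Admissibility of a relaxed control at `x`, i.e. membership in `V^r(x)`. -/
def IsRelaxed (x : Fin n → ℝ) (Θ : RControl U) : Prop :=
  Measurable Θ.time ∧ (∀ t, IsProbabilityMeasure (Θ.time t)) ∧
    (∀ᵐ t ∂(volume.restrict (S.fs x)), Θ.time t (S.feas (S.φ x t)) = 1) ∧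
    IsProbabilityMeasure Θ.bdry ∧
    (S.ts x < ⊤ → Θ.bdry (S.feas (S.φ x (S.tsR x))) = 1)

/-- The relaxed control `u_φ(x)` induced by a feedback selector `u`. -/
def feedback (u : (Fin n → ℝ) → U) (x : Fin n → ℝ) : RControl U :=
  ⟨fun t => Measure.dirac (u (S.φ x t)), Measure.dirac (u (S.φ x (S.tsR x)))⟩

/-- Ordinary feedback measurable selectors: `u(y) ∈ 𝕌(y)`. -/
def IsSelector (u : (Fin n → ℝ) → U) : Prop :=
  Measurable u ∧ ∀ y ∈ closure S.E, u y ∈ S.feas y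

/-- Membership of `v` in `M^ac(E)` with derivative `Xv` along the flow; boundary values of `v`
are the limits along the flow. -/
def MemMac (v Xv : (Fin n → ℝ) → ℝ) : Prop :=
  Measurable v ∧ Measurable Xv ∧
    (∀ x ∈ S.E, ∀ t ∈ S.fs x,
      IntervalIntegrable (fun s => Xv (S.φ x s)) volume 0 t ∧
        v (S.φ x t) - v x = ∫ s in (0 : ℝ)..t, Xv (S.φ x s)) ∧
    (∀ x ∈ S.E, S.ts x < ⊤ →
      Tendsto (fun t => v (S.φ x t)) (𝓝[<] S.tsR x) (𝓝 (v (S.φ x (S.tsR x)))))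

/-- The weighted supremum norm `‖h‖_g = sup_{x ∈ E} |h(x)|/g(x)`. -/
def gnorm (h g : (Fin n → ℝ) → ℝ) : ℝ := sSup ((fun x => |h x| / g x) '' S.E)

/-- Membership in `B_g(E)`. -/
def memBg (h g : (Fin n → ℝ) → ℝ) : Prop :=
  Measurable h ∧ BddAbove ((fun x => |h x| / g x) '' S.E)

/-- `v(y,μ) = ∫ v(y,u) μ(du)` for a nonnegative cost `v` on `Ē × U`, as a function of the
state and a measure on actions. -/
def mix (_S : Setting n U) (v : (Fin n → ℝ) → U → ℝ) : (Fin n → ℝ) → Measure U → ℝ≥0∞ :=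
  fun y m => ∫⁻ u, ENNReal.ofReal (v y u) ∂m

/-- The quantity `-ρ 𝓛_α(x,Θ) + L_α f(x,Θ) + H_α r(x,Θ) + G_α h(x,Θ)` appearing in the
one-stage optimization problems, valued in the extended reals. -/
def oneStage (α ρ : ℝ) (f r : (Fin n → ℝ) → U → ℝ) (h : (Fin n → ℝ) → ℝ) (x : Fin n → ℝ)
    (Θ : RControl U) : EReal :=
  (-(ρ : EReal)) * ((S.curlyL α x Θ : ℝ≥0∞) : EReal)
    + ((S.Lop α (S.mix f) x Θ : ℝ≥0∞) : EReal)
    + ((S.Hop α (S.mix r) x Θ : ℝ≥0∞) : EReal) + S.GopS α h x Θ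

end Setting

/-- The basic structural assumptions on the data of the control problem. -/
structure Basic [TopologicalSpace U] (S : Setting n U) : Prop where
  openE : IsOpen S.E
  nonemptyE : S.E.Nonempty
  contFlow : Continuous (Function.uncurry S.φ)
  flowZero : ∀ x, S.φ x 0 = x
  flowAdd : ∀ x s t, 0 ≤ s → 0 ≤ t → S.φ x (s + t) = S.φ (S.φ x s) t
  feasCompact : ∀ y ∈ closure S.E, IsCompact (S.feas y)
  feasNonempty : ∀ y ∈ closure S.E, (S.feas y).Nonempty
  lamMeas : Measurable (Function.uncurry S.lam)
  lamNonneg : ∀ y ∈ closure S.E, ∀ u, 0 ≤ S.lam y u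
  Qprob : ∀ y u, IsProbabilityMeasure (S.Q y u)
  QsuppE : ∀ y u, S.Q y u S.E = 1
  Qmeas : Measurable fun p : (Fin n → ℝ) × U => S.Q p.1 p.2

/-- The expected growth condition (Assumption 3.1 of the paper, inequalities (Cu1)/(Cu2)). -/
structure ExpGrowth (S : Setting n U) (b c : ℝ) (g Xg rbar : (Fin n → ℝ) → ℝ) : Prop where
  b_nonneg : 0 ≤ b
  c_pos : 0 < c
  g_ge_one : ∀ y, 1 ≤ g y
  g_mac : S.MemMac g Xg
  rbar_meas : Measurable rbar
  rbar_nonneg : ∀ z ∈ frontier S.E, 0 ≤ rbar z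
  drift : ∀ x ∈ S.E, ∀ a ∈ S.feas x,
    ((Xg x + c * g x : ℝ) : EReal)
        + ((ENNReal.ofReal (S.lam x a) * S.Qpt (fun z => ENNReal.ofReal (g z)) x a : ℝ≥0∞) :
            EReal)
      ≤ ((b + S.lam x a * g x : ℝ) : EReal)
  bdryGrowth : ∀ x ∈ S.E, S.ts x < ⊤ → ∀ a ∈ S.feas (S.φ x (S.tsR x)),
    ENNReal.ofReal (rbar (S.φ x (S.tsR x)))
        + S.Qpt (fun z => ENNReal.ofReal (g z)) (S.φ x (S.tsR x)) a
      ≤ ENNReal.ofReal (g (S.φ x (S.tsR x)))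

/-- The full expected growth condition: the bounds on the running and boundary costs
(inequalities (Cu3)/(Cu3a) of Assumption 3.1 of the paper). -/
structure CostBound (S : Setting n U) (c δ M : ℝ) (g rbar : (Fin n → ℝ) → ℝ)
    (f r : (Fin n → ℝ) → U → ℝ) : Prop where
  δ_pos : 0 < δ
  M_nonneg : 0 ≤ M
  f_meas : Measurable (Function.uncurry f)
  f_nonneg : ∀ y ∈ closure S.E, ∀ u, 0 ≤ f y u
  r_meas : Measurable (Function.uncurry r)
  r_nonneg : ∀ z ∈ frontier S.E, ∀ u, 0 ≤ r z u
  f_bound : ∀ x ∈ S.E, ∀ a ∈ S.feas x, f x a ≤ M * g x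
  r_bound : ∀ x ∈ S.E, S.ts x < ⊤ → ∀ a ∈ S.feas (S.φ x (S.tsR x)),
    r (S.φ x (S.tsR x)) a ≤ M / (c + δ) * rbar (S.φ x (S.tsR x))

/-- The lower-rate condition (parts of Assumptions 3.2 and 3.7 of the paper). -/
structure LowerRate (S : Setting n U) (c : ℝ) (lamL : (Fin n → ℝ) → ℝ) (Kl : ℝ) : Prop where
  lamL_meas : Measurable lamL
  lamL_nonneg : ∀ y, 0 ≤ lamL y
  Kl_nonneg : 0 ≤ Kl
  lam_ge : ∀ y ∈ S.E, ∀ a ∈ S.feas y, lamL y ≤ S.lam y a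
  lamL_locInt : ∀ x ∈ S.E, ∀ t ∈ S.fs x,
    IntervalIntegrable (fun s => lamL (S.φ x s)) volume 0 t
  lamL_intTs : ∀ x ∈ S.E, S.ts x < ⊤ →
    IntervalIntegrable (fun s => lamL (S.φ x s)) volume 0 (S.tsR x)
  intBound : ∀ x ∈ S.E,
    (∫⁻ t in S.fs x,
        ENNReal.ofReal (Real.exp (c * t - ∫ s in (0 : ℝ)..t, lamL (S.φ x s))))
      ≤ ENNReal.ofReal Kl
  supInt : ∀ x ∈ S.E, ∀ t ∈ S.fs x,
    (∫⁻ s in Set.Ioc (0 : ℝ) t, ⨆ a ∈ S.feas (S.φ x s), ENNReal.ofReal (S.lam (S.φ x s) a)) < ⊤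
  supIntTs : ∀ x ∈ S.E, S.ts x < ⊤ →
    (∫⁻ s in Set.Ioc (0 : ℝ) (S.tsR x),
        ⨆ a ∈ S.feas (S.φ x s), ENNReal.ofReal (S.lam (S.φ x s) a)) < ⊤

end

end PDMP

open MeasureTheory ENNReal Set Filter Topology

lemma exp_neg_dist_le {a b : ℝ} (ha : 0 ≤ a) (hb : 0 ≤ b) :
    dist (Real.exp (-a)) (Real.exp (-b)) ≤ dist a b := by
  wlog hab : a ≤ b with H
  · rw [dist_comm, dist_comm a b]; exact H hb ha (le_of_not_ge hab)
  rw [Real.dist_eq, Real.dist_eq, abs_sub_comm a b, abs_of_nonneg, abs_of_nonneg]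
  · have h1 : Real.exp (-b) = Real.exp (-a) * Real.exp (-(b - a)) := by
      rw [← Real.exp_add]; congr 1; ring
    have h2 := Real.add_one_le_exp (-(b - a))
    have h3 : Real.exp (-a) ≤ 1 := Real.exp_le_one_iff.mpr (by linarith)
    have h4 := Real.exp_pos (-a)
    rw [h1]
    nlinarith
  · linarith
  · have : Real.exp (-b) ≤ Real.exp (-a) := Real.exp_le_exp.mpr (by linarith)
    linarith

lemma key_ineq (T : ℝ) (hT : 0 ≤ T) (ξ ℓ h : ℝ → ℝ)
    (hξ : IntervalIntegrable ξ volume 0 T) (hℓ : IntervalIntegrable ℓ volume 0 T)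
    (hℓ0 : ∀ t ∈ Icc 0 T, 0 ≤ ℓ t)
    (hh : ∀ t ∈ Icc 0 T, h t = h 0 + ∫ s in (0 : ℝ)..t, ξ s)
    (k : ℝ → ℝ≥0∞)
    (hk : ∀ t ∈ Icc 0 T, 0 ≤ ℓ t * h t - ξ t ∧ k t ≤ ENNReal.ofReal (ℓ t * h t - ξ t))
    (hT0 : 0 ≤ h T) :
    (∫⁻ t in Icc 0 T, ENNReal.ofReal (Real.exp (-∫ s in (0 : ℝ)..t, ℓ s)) * k t)
      + ENNReal.ofReal (Real.exp (-∫ s in (0 : ℝ)..T, ℓ s) * h T) ≤ ENNReal.ofReal (h 0) := by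
  set P : ℝ → ℝ := fun t => ∫ s in (0 : ℝ)..t, ℓ s with hP
  set W : ℝ → ℝ := fun t => Real.exp (-P t) with hW
  set H : ℝ → ℝ := fun t => h 0 + ∫ s in (0 : ℝ)..t, ξ s with hH
  have hPac : AbsolutelyContinuousOnInterval P 0 T :=
    hℓ.absolutelyContinuousOnInterval_intervalIntegral (by simp)
  have hP0 : ∀ t ∈ uIcc 0 T, 0 ≤ P t := by
    intro t ht
    rw [uIcc_of_le hT] at ht
    exact intervalIntegral.integral_nonneg ht.1 fun u hu => hℓ0 u ⟨hu.1, hu.2.trans ht.2⟩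
  have hWac : AbsolutelyContinuousOnInterval W 0 T := by
    rw [absolutelyContinuousOnInterval_iff] at hPac ⊢
    intro ε hε
    obtain ⟨d, hd, hd'⟩ := hPac ε hε
    refine ⟨d, hd, fun E hE hlt => lt_of_le_of_lt (Finset.sum_le_sum fun i hi => ?_) (hd' E hE hlt)⟩
    have := hE.1 i hi
    exact exp_neg_dist_le (hP0 _ this.1) (hP0 _ this.2)
  have hHac : AbsolutelyContinuousOnInterval H 0 T := by
    have h1 : AbsolutelyContinuousOnInterval (fun _ : ℝ => h 0) 0 T := by
      simp only [AbsolutelyContinuousOnInterval, dist_self, Finset.sum_const_zero]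
      exact tendsto_const_nhds
    exact h1.add (hξ.absolutelyContinuousOnInterval_intervalIntegral (by simp))
  have hder := hWac.integral_deriv_mul_eq_sub hHac
  have hae : ∀ᵐ t, t ∈ uIoc 0 T → deriv W t * H t + W t * deriv H t
      = -(W t * (ℓ t * H t - ξ t)) := by
    filter_upwards [hℓ.ae_hasDerivAt_integral, hξ.ae_hasDerivAt_integral] with t h1 h2 ht
    have ht' := uIoc_subset_uIcc ht
    have d1 : HasDerivAt W (Real.exp (-P t) * -ℓ t) t := (h1 ht' 0 (by simp)).neg.exp
    have d2 : HasDerivAt H (ξ t) t := (h2 ht' 0 (by simp)).const_add _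
    rw [d1.deriv, d2.deriv]
    simp only [hW]; ring
  have hint : IntervalIntegrable (fun t => W t * (ℓ t * H t - ξ t)) volume 0 T :=
    ((hℓ.mul_continuousOn hHac.continuousOn).sub hξ).continuousOn_mul hWac.continuousOn
  rw [intervalIntegral.integral_congr_ae hae, intervalIntegral.integral_neg] at hder
  have hHh : ∀ t ∈ Icc 0 T, H t = h t := fun t ht => (hh t ht).symm
  have hW0 : W 0 = 1 := by simp [hW, hP]
  rw [hW0, hHh T ⟨hT, le_rfl⟩, hHh 0 ⟨le_rfl, hT⟩] at hder
  have hnn : ∀ t ∈ Icc 0 T, 0 ≤ W t * (ℓ t * H t - ξ t) := fun t ht => by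
    rw [hHh t ht]; exact mul_nonneg (Real.exp_pos _).le (hk t ht).1
  have hle : (∫⁻ t in Icc 0 T, ENNReal.ofReal (W t) * k t)
      ≤ ENNReal.ofReal (∫ t in (0 : ℝ)..T, W t * (ℓ t * H t - ξ t)) := by
    rw [intervalIntegral.integral_of_le hT, ← integral_Icc_eq_integral_Ioc,
      ofReal_integral_eq_lintegral_ofReal]
    · refine setLIntegral_mono' measurableSet_Icc fun t ht => ?_
      rw [hHh t ht, ENNReal.ofReal_mul (Real.exp_pos _).le]
      gcongr
      exact (hk t ht).2
    · have := (intervalIntegrable_iff_integrableOn_Ioc_of_le hT).1 hint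
      exact (integrableOn_Icc_iff_integrableOn_Ioc enorm_ne_top).2 this
    · exact (ae_restrict_iff' measurableSet_Icc).2 (Eventually.of_forall hnn)
  have hI0 : 0 ≤ ∫ t in (0 : ℝ)..T, W t * (ℓ t * H t - ξ t) :=
    intervalIntegral.integral_nonneg hT hnn
  calc _ ≤ ENNReal.ofReal (∫ t in (0 : ℝ)..T, W t * (ℓ t * H t - ξ t))
        + ENNReal.ofReal (W T * h T) := by gcongr
    _ = ENNReal.ofReal (h 0) := by
      rw [← ENNReal.ofReal_add hI0 (mul_nonneg (Real.exp_pos _).le hT0)]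
      congr 1; linarith

open PDMP

section helpers

variable {n : ℕ} {U : Type*} [MeasurableSpace U] [MetricSpace U] [BorelSpace U]
  (S : Setting n U)

lemma cont_flow (hS : Basic S) (x : Fin n → ℝ) : Continuous fun t => S.φ x t :=
  hS.contFlow.comp (Continuous.prodMk_right x)

lemma ts_pos (hS : Basic S) {x : Fin n → ℝ} (hx : x ∈ S.E) : 0 < S.ts x := by
  have h0 : ∀ᶠ t in 𝓝 (0 : ℝ), S.φ x t ∈ S.E := by
    apply (cont_flow S hS x).continuousAt.eventually_mem
    rw [hS.flowZero]
    exact hS.openE.mem_nhds hx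
  obtain ⟨ε, hε, hball⟩ := Metric.eventually_nhds_iff.1 h0
  refine lt_of_lt_of_le (ENNReal.ofReal_pos.2 hε) (le_sInf ?_)
  rintro T ⟨t, ht, hfr, rfl⟩
  apply ENNReal.ofReal_le_ofReal
  by_contra hlt
  have hE : S.φ x t ∈ S.E := hball (by rw [Real.dist_eq, sub_zero, abs_of_pos ht]; linarith)
  rw [hS.openE.frontier_eq] at hfr
  exact hfr.2 hE

lemma mem_E (hS : Basic S) {x : Fin n → ℝ} (hx : x ∈ S.E) {t : ℝ} (ht : t ∈ S.fs x) :
    S.φ x t ∈ S.E := by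
  have hc : IsPreconnected ((fun s => S.φ x s) '' Icc 0 t) :=
    isPreconnected_Icc.image _ (cont_flow S hS x).continuousOn
  have hsub : ((fun s => S.φ x s) '' Icc 0 t) ⊆ S.E := by
    refine hc.subset_left_of_subset_union hS.openE isClosed_closure.isOpen_compl
      (v := (closure S.E)ᶜ) ?_ ?_ ?_
    · exact (disjoint_compl_right).mono_left subset_closure
    · rintro _ ⟨s, hs, rfl⟩
      by_contra hcon
      simp only [mem_union, mem_compl_iff, not_or, not_not] at hcon
      have hfr : S.φ x s ∈ frontier S.E := by
        rw [hS.openE.frontier_eq]; exact ⟨hcon.2, hcon.1⟩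
      rcases hs.1.eq_or_lt with h | h
      · subst h
        apply hcon.1; rw [hS.flowZero]; exact hx
      · have : S.ts x ≤ ENNReal.ofReal s := sInf_le ⟨s, h, hfr, rfl⟩
        exact absurd (this.trans (ENNReal.ofReal_le_ofReal hs.2)) (not_le.2 ht.2)
    · exact ⟨x, ⟨0, ⟨le_rfl, ht.1⟩, hS.flowZero x⟩, hx⟩
  exact hsub ⟨t, ⟨ht.1, le_rfl⟩, rfl⟩

lemma fs_down {x : Fin n → ℝ} {t s : ℝ} (ht : t ∈ S.fs x) (h0 : 0 ≤ s) (hs : s ≤ t) :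
    s ∈ S.fs x := ⟨h0, (ENNReal.ofReal_le_ofReal hs).trans_lt ht.2⟩

lemma mem_fs_iff {x : Fin n → ℝ} (h : S.ts x < ⊤) {t : ℝ} :
    t ∈ S.fs x ↔ 0 ≤ t ∧ t < S.tsR x := by
  refine and_congr_right fun h0 => ?_
  rw [Setting.tsR, ENNReal.ofReal_lt_iff_lt_toReal h0 h.ne]

lemma mem_closure_exit (hS : Basic S) {x : Fin n → ℝ} (hx : x ∈ S.E) (h : S.ts x < ⊤) :
    S.φ x (S.tsR x) ∈ closure S.E := by
  have hpos : 0 < S.tsR x := ENNReal.toReal_pos (ts_pos S hS hx).ne' h.ne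
  have ht : Tendsto (fun t => S.φ x t) (𝓝[<] (S.tsR x)) (𝓝 (S.φ x (S.tsR x))) :=
    (cont_flow S hS x).continuousAt.tendsto.mono_left nhdsWithin_le_nhds
  refine mem_closure_of_tendsto ht ?_
  filter_upwards [Ioo_mem_nhdsLT hpos] with t htt
  exact mem_E S hS hx ((mem_fs_iff S h).2 ⟨htt.1.le, htt.2⟩)

lemma lintegral_fs {x : Fin n → ℝ} (h0 : 0 < S.ts x) (F : ℝ → ℝ≥0∞) (C H : ℝ≥0∞)
    (hT : ∀ T ∈ S.fs x, (∫⁻ t in Icc 0 T, F t) + C ≤ H) :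
    (∫⁻ t in S.fs x, F t) + C ≤ H := by
  let ι := {p : ℚ // (p : ℝ) ∈ S.fs x}
  have hU : S.fs x = ⋃ i : ι, Icc (0 : ℝ) (i.1 : ℝ) := by
    ext t
    simp only [mem_iUnion]
    constructor
    · intro ht
      obtain ⟨p, hp0, h1, h2⟩ := ENNReal.lt_iff_exists_rat_btwn.1 ht.2
      have hp0' : (0 : ℝ) ≤ p := by exact_mod_cast hp0
      refine ⟨⟨p, hp0', h2⟩, ht.1, ?_⟩
      by_contra hcon
      exact absurd (ENNReal.ofReal_le_ofReal (le_of_not_ge hcon)) (not_le.2 h1)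
    · rintro ⟨i, hi⟩
      exact fs_down S i.2 hi.1 hi.2
  haveI : Nonempty ι := ⟨⟨0, by simp [Setting.fs, h0]⟩⟩
  have hdir : Directed (· ⊆ ·) fun i : ι => Icc (0 : ℝ) (i.1 : ℝ) := by
    intro i j
    rcases le_total i.1 j.1 with h | h
    · exact ⟨j, Icc_subset_Icc_right (by exact_mod_cast h), subset_rfl⟩
    · exact ⟨i, subset_rfl, Icc_subset_Icc_right (by exact_mod_cast h)⟩
  rw [hU, setLIntegral_iUnion_of_directed _ hdir, ENNReal.iSup_add]
  exact iSup_le fun i => hT _ i.2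

/-- Jump rate along the flow under the feedback selector. -/
noncomputable def rate (u : (Fin n → ℝ) → U) (x : Fin n → ℝ) (t : ℝ) : ℝ :=
  S.lam (S.φ x t) (u (S.φ x t))

lemma rate_meas (hS : Basic S) {u : (Fin n → ℝ) → U} (hu : S.IsSelector u) (x : Fin n → ℝ) :
    Measurable (rate S u x) := by
  have h1 : Measurable fun t => S.φ x t := (cont_flow S hS x).measurable
  exact hS.lamMeas.comp (h1.prodMk (hu.1.comp h1))

lemma Lam_eq (u : (Fin n → ℝ) → U) (x : Fin n → ℝ) (t : ℝ) :
    S.Lam x (S.feedback u x) t = ∫⁻ s in Ioc (0 : ℝ) t, ENNReal.ofReal (rate S u x s) := by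
  simp only [Setting.Lam, Setting.lamMix, Setting.feedback, lintegral_dirac, rate]

/-- The rate is integrable on `[0,T]` and the weight is the usual exponential. -/
lemma weight_eq (hS : Basic S) {u : (Fin n → ℝ) → U} (hu : S.IsSelector u)
    {x : Fin n → ℝ} {T : ℝ} (hT : 0 ≤ T)
    (hcl : ∀ t ∈ Ioc 0 T, S.φ x t ∈ closure S.E)
    (hfin : (∫⁻ s in Set.Ioc (0 : ℝ) T,
        ⨆ a ∈ S.feas (S.φ x s), ENNReal.ofReal (S.lam (S.φ x s) a)) < ⊤) (α : ℝ) :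
    IntervalIntegrable (rate S u x) volume 0 T ∧
    S.weight α x (S.feedback u x) T
      = ENNReal.ofReal (Real.exp (-∫ s in (0 : ℝ)..T, (α + rate S u x s))) := by
  have hnn : ∀ᵐ t ∂(volume.restrict (Ioc 0 T)), 0 ≤ rate S u x t :=
    (ae_restrict_iff' measurableSet_Ioc).2
      (Eventually.of_forall fun t ht => hS.lamNonneg _ (hcl t ht) _)
  have hlt : (∫⁻ s in Ioc (0 : ℝ) T, ENNReal.ofReal (rate S u x s)) < ⊤ := by
    refine lt_of_le_of_lt (setLIntegral_mono' measurableSet_Ioc fun s hs => ?_) hfin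
    exact le_iSup₂_of_le (u (S.φ x s)) (hu.2 _ (hcl s hs)) le_rfl
  have hint : IntegrableOn (rate S u x) (Ioc 0 T) volume := by
    refine ⟨(rate_meas S hS hu x).aestronglyMeasurable, ?_⟩
    rw [hasFiniteIntegral_iff_ofReal hnn]
    exact hlt
  have hii : IntervalIntegrable (rate S u x) volume 0 T :=
    (intervalIntegrable_iff_integrableOn_Ioc_of_le hT).2 hint
  refine ⟨hii, ?_⟩
  rw [Setting.weight, Lam_eq, if_neg hlt.ne,
    intervalIntegral.integral_add intervalIntegrable_const hii,
    intervalIntegral.integral_of_le hT (f := rate S u x),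
    integral_eq_lintegral_of_nonneg_ae hnn (rate_meas S hS hu x).aestronglyMeasurable]
  congr 2
  simp
  ring

lemma Qpt_affine (hS : Basic S) (g : (Fin n → ℝ) → ℝ) (hg : Measurable g) (hg1 : ∀ y, 1 ≤ g y)
    {A B : ℝ} (hA : 0 ≤ A) (p : (Fin n → ℝ) → ℝ≥0∞)
    (hp : ∀ z ∈ S.E, p z ≤ ENNReal.ofReal (A * g z) + ENNReal.ofReal B)
    (y : Fin n → ℝ) (a : U) :
    S.Qpt p y a ≤ ENNReal.ofReal A * S.Qpt (fun z => ENNReal.ofReal (g z)) y a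
      + ENNReal.ofReal B := by
  calc S.Qpt p y a ≤ ∫⁻ z in S.E, (ENNReal.ofReal A * ENNReal.ofReal (g z) + ENNReal.ofReal B)
        ∂(S.Q y a) := by
        refine setLIntegral_mono' hS.openE.measurableSet fun z hz => ?_
        rw [← ENNReal.ofReal_mul hA]; exact hp z hz
    _ = _ := by
      rw [lintegral_add_right _ measurable_const, lintegral_const_mul _ hg.ennreal_ofReal]
      simp [Setting.Qpt, hS.QsuppE]

end helpers

lemma drift_real {Xg c g b lam : ℝ} {κ : ℝ≥0∞}
    (h : ((Xg + c * g : ℝ) : EReal) + (κ : EReal) ≤ ((b + lam * g : ℝ) : EReal)) :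
    κ ≠ ⊤ ∧ Xg + c * g + κ.toReal ≤ b + lam * g := by
  have hκ : κ ≠ ⊤ := by
    rintro rfl
    rw [EReal.coe_ennreal_top, EReal.coe_add_top, top_le_iff] at h
    exact EReal.coe_ne_top _ h
  refine ⟨hκ, ?_⟩
  lift κ to NNReal using hκ
  have : ((κ : ℝ≥0∞) : EReal) = ((κ : ℝ) : EReal) := rfl
  rw [this, ← EReal.coe_add, EReal.coe_le_coe_iff] at h
  simpa using h

lemma one_step {n : ℕ} {U : Type*} [MeasurableSpace U] [MetricSpace U] [BorelSpace U]
    (S : Setting n U) (hS : Basic S)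
    (b c δ M : ℝ) (g Xg rbar lamL : (Fin n → ℝ) → ℝ) (Kl : ℝ)
    (f r : (Fin n → ℝ) → U → ℝ)
    (hEG : ExpGrowth S b c g Xg rbar) (hCB : CostBound S c δ M g rbar f r)
    (hLR : LowerRate S c lamL Kl)
    (α : ℝ) (hα0 : 0 < α) (hαδ : α < δ)
    (u : (Fin n → ℝ) → U) (hu : S.IsSelector u)
    (p : (Fin n → ℝ) → ℝ≥0∞)
    (hp : ∀ z ∈ S.E, p z ≤ ENNReal.ofReal (M / (c + α) * g z) + ENNReal.ofReal (M * b / (c * α)))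
    (x : Fin n → ℝ) (hx : x ∈ S.E) :
    S.Lop α (S.mix f) x (S.feedback u x) + S.Hop α (S.mix r) x (S.feedback u x)
      + S.Gop α p x (S.feedback u x)
      ≤ ENNReal.ofReal (M / (c + α) * g x) + ENNReal.ofReal (M * b / (c * α)) := by
  have hc := hEG.c_pos
  have hb := hEG.b_nonneg
  have hM := hCB.M_nonneg
  have hg1 := hEG.g_ge_one
  obtain ⟨hgm, hXm, hac, hlim⟩ := hEG.g_mac
  set A := M / (c + α) with hA
  set B := M * b / (c * α) with hB
  have hA0 : 0 ≤ A := by positivity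
  have hB0 : 0 ≤ B := by positivity
  have hAM : A * (c + α) = M := by rw [hA]; field_simp
  have hBA : A * b ≤ B * α := by
    have e1 : B * α = M * b / c := by rw [hB]; field_simp
    have e2 : A * b = M * b / (c + α) := by rw [hA]; ring
    rw [e1, e2]
    exact div_le_div_of_nonneg_left (by positivity) hc (by linarith)
  have hQ := Qpt_affine S hS g hgm hg1 hA0 p hp
  set h : ℝ → ℝ := fun t => A * g (S.φ x t) + B with hh
  have hgp : ∀ y, 0 ≤ A * g y := fun y => mul_nonneg hA0 (zero_le_one.trans (hg1 y))
  have hhnn : ∀ t, 0 ≤ h t := fun t => add_nonneg (hgp _) hB0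
  have hh0 : ENNReal.ofReal (A * g x) + ENNReal.ofReal B = ENNReal.ofReal (h 0) := by
    rw [← ENNReal.ofReal_add (hgp x) hB0]; simp only [hh, hS.flowZero]
  have hts := ts_pos S hS hx
  set k : ℝ → ℝ≥0∞ := fun t => ENNReal.ofReal (f (S.φ x t) (u (S.φ x t)))
    + ENNReal.ofReal (rate S u x t) * S.Qpt p (S.φ x t) (u (S.φ x t)) with hk
  set ℓ : ℝ → ℝ := fun t => α + rate S u x t with hℓ
  set W : ℝ → ℝ := fun t => Real.exp (-∫ s in (0 : ℝ)..t, ℓ s) with hW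
  set w := fun t => S.weight α x (S.feedback u x) t with hw
  have hEfs : ∀ t ∈ S.fs x, S.φ x t ∈ S.E := fun t ht => mem_E S hS hx ht
  have hlamnn : ∀ t ∈ S.fs x, 0 ≤ rate S u x t := fun t ht =>
    hS.lamNonneg _ (subset_closure (hEfs t ht)) _
  have hrate : ∀ T ∈ S.fs x, IntervalIntegrable (rate S u x) volume 0 T ∧
      w T = ENNReal.ofReal (W T) := fun T hT =>
    weight_eq S hS hu hT.1
      (fun t ht => subset_closure (hEfs t (fs_down S hT ht.1.le ht.2))) (hLR.supInt x hx T hT) α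
  -- pointwise drift inequality
  have hkb : ∀ t ∈ S.fs x, 0 ≤ ℓ t * h t - A * Xg (S.φ x t) ∧
      k t ≤ ENNReal.ofReal (ℓ t * h t - A * Xg (S.φ x t)) := by
    intro t ht
    have hE := hEfs t ht
    have hfe := hu.2 _ (subset_closure hE)
    obtain ⟨hκ, hd⟩ := drift_real (hEG.drift _ hE _ hfe)
    have hfb := hCB.f_bound _ hE _ hfe
    have hf0 := hCB.f_nonneg _ (subset_closure hE) (u (S.φ x t))
    have hl0 := hlamnn t ht
    set Qg := S.Qpt (fun z => ENNReal.ofReal (g z)) (S.φ x t) (u (S.φ x t)) with hQg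
    set κ := ENNReal.ofReal (S.lam (S.φ x t) (u (S.φ x t))) * Qg with hκd
    have hκ0 : 0 ≤ κ.toReal := ENNReal.toReal_nonneg
    have hmain : f (S.φ x t) (u (S.φ x t)) + (A * κ.toReal + B * rate S u x t)
        ≤ ℓ t * h t - A * Xg (S.φ x t) := by
      have h1 := mul_le_mul_of_nonneg_left hd hA0
      have h2 : M * g (S.φ x t) = A * (c + α) * g (S.φ x t) := by rw [hAM]
      simp only [hℓ, hh]
      change A * (_) ≤ A * (b + rate S u x t * g (S.φ x t)) at h1
      nlinarith
    refine ⟨le_trans (by positivity) hmain, ?_⟩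
    refine le_trans ?_ (ENNReal.ofReal_le_ofReal hmain)
    rw [ENNReal.ofReal_add hf0 (by positivity), ENNReal.ofReal_add (by positivity) (by positivity),
      ENNReal.ofReal_mul hA0, ENNReal.ofReal_toReal hκ, ENNReal.ofReal_mul hB0]
    simp only [hk]
    gcongr
    calc _ ≤ ENNReal.ofReal (rate S u x t) * (ENNReal.ofReal A * Qg + ENNReal.ofReal B) := by
          gcongr; exact hQ _ _
      _ = _ := by rw [hκd, rate]; ring
  -- finite-horizon inequality
  have hfinite : ∀ T ∈ S.fs x, (∫⁻ t in Icc 0 T, w t * k t) + ENNReal.ofReal (W T * h T)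
      ≤ ENNReal.ofReal (h 0) := by
    intro T hT
    have hsub : ∀ t ∈ Icc 0 T, t ∈ S.fs x := fun t ht => fs_down S hT ht.1 ht.2
    have e : (∫⁻ t in Icc 0 T, w t * k t) = ∫⁻ t in Icc 0 T, ENNReal.ofReal (W t) * k t :=
      setLIntegral_congr_fun measurableSet_Icc fun t ht => by
        simp only [(hrate t (hsub t ht)).2]
    rw [e]
    refine key_ineq T hT.1 (fun t => A * Xg (S.φ x t)) ℓ h ?_ ?_ ?_ ?_ k ?_ (hhnn T)
    · exact (hac x hx T hT).1.const_mul A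
    · exact intervalIntegrable_const.add (hrate T hT).1
    · exact fun t ht => add_nonneg hα0.le (hlamnn t (hsub t ht))
    · intro t ht
      have := (hac x hx t (hsub t ht)).2
      rw [intervalIntegral.integral_const_mul, ← this]
      simp only [hh, hS.flowZero]; ring
    · exact fun t ht => hkb t (hsub t ht)
  -- boundary term
  set C : ℝ≥0∞ := S.Hop α (S.mix r) x (S.feedback u x)
    + S.Hop α (fun y m => S.QMix p y m) x (S.feedback u x) with hC
  have hCbound : ∀ T ∈ S.fs x, (∫⁻ t in Icc 0 T, w t * k t) + C ≤ ENNReal.ofReal (h 0) := by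
    intro T hT
    by_cases htop : S.ts x < ⊤
    · have hpos : 0 < S.tsR x := ENNReal.toReal_pos hts.ne' htop.ne
      have hz := mem_closure_exit S hS hx htop
      have hTlt := ((mem_fs_iff S htop).1 hT).2
      obtain ⟨hii, hwe⟩ := weight_eq S hS hu (T := S.tsR x) hpos.le
        (fun t ht => by
          rcases ht.2.eq_or_lt with h | h
          · rw [h]; exact hz
          · exact subset_closure (hEfs t ((mem_fs_iff S htop).2 ⟨ht.1.le, h⟩)))
        (hLR.supIntTs x hx htop) α
      have hlimW : Tendsto W (𝓝[<] (S.tsR x)) (𝓝 (W (S.tsR x))) := by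
        have hcont : ContinuousOn (fun t => ∫ s in (0 : ℝ)..t, ℓ s) (uIcc 0 (S.tsR x)) :=
          intervalIntegral.continuousOn_primitive_interval'
            (intervalIntegrable_const.add hii) (by simp)
        rw [uIcc_of_le hpos.le] at hcont
        have h1 : Tendsto (fun t => ∫ s in (0 : ℝ)..t, ℓ s) (𝓝[<] (S.tsR x))
            (𝓝 (∫ s in (0 : ℝ)..(S.tsR x), ℓ s)) := by
          refine (hcont (S.tsR x) ⟨hpos.le, le_rfl⟩).tendsto.mono_left ?_
          rw [← nhdsWithin_Ioo_eq_nhdsLT hpos]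
          exact nhdsWithin_mono _ Ioo_subset_Icc_self
        exact (Real.continuous_exp.tendsto _).comp h1.neg
      have hlimh : Tendsto h (𝓝[<] (S.tsR x)) (𝓝 (h (S.tsR x))) :=
        ((hlim x hx htop).const_mul A).add_const B
      have hlimall : Tendsto (fun t => (∫⁻ t in Icc 0 T, w t * k t) + ENNReal.ofReal (W t * h t))
          (𝓝[<] (S.tsR x)) (𝓝 ((∫⁻ t in Icc 0 T, w t * k t)
            + ENNReal.ofReal (W (S.tsR x) * h (S.tsR x)))) :=
        tendsto_const_nhds.add ((ENNReal.tendsto_ofReal (hlimW.mul hlimh)))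
      have hle1 : (∫⁻ t in Icc 0 T, w t * k t) + ENNReal.ofReal (W (S.tsR x) * h (S.tsR x))
          ≤ ENNReal.ofReal (h 0) := by
        refine le_of_tendsto hlimall ?_
        filter_upwards [Ioo_mem_nhdsLT hTlt] with t ht
        refine le_trans ?_ (hfinite t ((mem_fs_iff S htop).2 ⟨hT.1.trans ht.1.le, ht.2⟩))
        gcongr
        exact ht.1.le
      refine le_trans ?_ hle1
      gcongr
      have hfe := hu.2 _ hz
      have hbg := hEG.bdryGrowth x hx htop _ hfe
      have hrb := hCB.r_bound x hx htop _ hfe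
      simp only [hC, Setting.Hop, if_pos htop, Setting.mix, Setting.QMix, Setting.feedback,
        lintegral_dirac]
      rw [← mul_add]
      change S.weight α x (S.feedback u x) (S.tsR x) * _ ≤ _
      rw [hwe, ENNReal.ofReal_mul (Real.exp_pos _).le]
      gcongr
      set z := S.φ x (S.tsR x) with hzd
      have hδ0 := hCB.δ_pos
      have hMA : M / (c + δ) ≤ A :=
        div_le_div_of_nonneg_left hM (by positivity) (by linarith)
      calc ENNReal.ofReal (r z (u z)) + S.Qpt p z (u z)
          ≤ ENNReal.ofReal A * ENNReal.ofReal (rbar z) + (ENNReal.ofReal A *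
              S.Qpt (fun z => ENNReal.ofReal (g z)) z (u z) + ENNReal.ofReal B) := by
            refine add_le_add ?_ (hQ _ _)
            refine (ENNReal.ofReal_le_ofReal hrb).trans ?_
            rw [ENNReal.ofReal_mul (by positivity)]
            gcongr
        _ = ENNReal.ofReal A * (ENNReal.ofReal (rbar z)
              + S.Qpt (fun z => ENNReal.ofReal (g z)) z (u z)) + ENNReal.ofReal B := by ring
        _ ≤ ENNReal.ofReal A * ENNReal.ofReal (g z) + ENNReal.ofReal B := by gcongr
        _ = ENNReal.ofReal (h (S.tsR x)) := by
            rw [← ENNReal.ofReal_mul hA0, ← ENNReal.ofReal_add (hgp z) hB0]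
    · have hC0 : C = 0 := by simp [hC, Setting.Hop, if_neg htop]
      rw [hC0, add_zero]
      exact le_self_add.trans (hfinite T hT)
  have hfinal := lintegral_fs S hts _ C _ hCbound
  rw [hh0]
  refine le_trans (le_of_eq ?_) hfinal
  have hmeasw : AEMeasurable w (volume.restrict (S.fs x)) := by
    have hmono : Monotone fun t => S.Lam x (S.feedback u x) t := fun s t hst =>
      lintegral_mono_set (Ioc_subset_Ioc_right hst)
    have hLm := hmono.measurable
    refine Measurable.aemeasurable ?_
    refine Measurable.ite (hLm (measurableSet_singleton ⊤)) measurable_const ?_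
    exact (Real.measurable_exp.comp
      ((measurable_id.const_mul α).neg.sub hLm.ennreal_toReal)).ennreal_ofReal
  have hsplit : (∫⁻ t in S.fs x, w t * k t)
      = S.Lop α (S.mix f) x (S.feedback u x)
        + S.Lop α (fun y m => S.lamQMix p y m) x (S.feedback u x) := by
    have h1 : Measurable fun t => S.φ x t := (cont_flow S hS x).measurable
    have hfm : Measurable fun t => ENNReal.ofReal (f (S.φ x t) (u (S.φ x t))) :=
      (hCB.f_meas.comp (h1.prodMk (hu.1.comp h1))).ennreal_ofReal
    simp only [Setting.Lop, Setting.mix, Setting.lamQMix, Setting.feedback, lintegral_dirac]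
    refine Eq.trans ?_ (lintegral_add_left' (hmeasw.mul hfm.aemeasurable) _)
    refine lintegral_congr fun t => ?_
    simp only [hk, mul_add]; rfl
  rw [hsplit, hC, Setting.Gop]
  abel

open PDMP MeasureTheory ENNReal Set Filter Topology

/-- Theorem 3.4(i) of the paper: under the full expected growth and lower-rate conditions, the
iterates `q_{m+1} = L_α f + H_α r + G_α q_m` (along any sequence of ordinary feedback
selectors) satisfy `q_m(x) ≤ (M/(c+α))·g(x) + M b/(c α)` for `α ∈ (0,δ)`. -/
theorem theorem_3_4_i {n : ℕ} {U : Type*} [MeasurableSpace U] [MetricSpace U]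
    [CompactSpace U] [BorelSpace U]
    (S : Setting n U) (hS : Basic S)
    (b c δ M : ℝ) (g Xg rbar lamL : (Fin n → ℝ) → ℝ) (Kl : ℝ)
    (f r : (Fin n → ℝ) → U → ℝ)
    (hEG : ExpGrowth S b c g Xg rbar) (hCB : CostBound S c δ M g rbar f r)
    (hLR : LowerRate S c lamL Kl)
    (α : ℝ) (hα0 : 0 < α) (hαδ : α < δ)
    (us : ℕ → (Fin n → ℝ) → U) (hus : ∀ m, S.IsSelector (us m))
    (q : ℕ → (Fin n → ℝ) → ℝ≥0∞)
    (hq_meas : ∀ m, Measurable (q m))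
    (hq0 : ∀ x, q 0 x = 0)
    (hq_rec : ∀ m : ℕ, ∀ x ∈ S.E,
      q (m + 1) x =
        S.Lop α (S.mix f) x (S.feedback (us (m + 1)) x)
          + S.Hop α (S.mix r) x (S.feedback (us (m + 1)) x)
          + S.Gop α (q m) x (S.feedback (us (m + 1)) x)) :
    ∀ m : ℕ, ∀ x ∈ S.E,
      q m x ≤ ENNReal.ofReal (M / (c + α) * g x) + ENNReal.ofReal (M * b / (c * α)) := by
  intro m
  induction m with
  | zero => intro x _; rw [hq0]; exact bot_le
  | succ m ih =>
    intro x hx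
    rw [hq_rec m x hx]
    exact one_step S hS b c δ M g Xg rbar lamL Kl f r hEG hCB hLR α hα0 hαδ _ (hus _) _ ih x hx
end

section
/- Under the full expected growth condition and the lower-rate condition, for every ordinary feedback selector u : Ē → U and every x ∈ E (writing L = L_0, H = H_0 for the undiscounted operators): 0 ≤ L f(x,u_φ(x)) + H r(x,u_φ(x)) ≤ (M(1+bK_λ)/c)·g(x) and 0 ≤ L g(x,u_φ(x)) ≤ ((1+bK_λ)/c)·g(x). -/
open MeasureTheory ENNReal Set Filter Topology

open PDMP MeasureTheory ENNReal Set Filter Topology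

theorem ac_lip_comp {f p : ℝ → ℝ} {a b : ℝ} {K : NNReal}
    (hf : AbsolutelyContinuousOnInterval f a b) (hp : LipschitzOnWith K p (f '' uIcc a b)) :
    AbsolutelyContinuousOnInterval (fun t => p (f t)) a b := by
  rw [absolutelyContinuousOnInterval_iff] at hf ⊢
  intro ε hε
  obtain ⟨δ, hδ, H⟩ := hf (ε / (K + 1)) (by positivity)
  refine ⟨δ, hδ, fun I hI hl => ?_⟩
  have h1 := H I hI hl
  calc _ ≤ ∑ i ∈ Finset.range I.1, K * dist (f (I.2 i).1) (f (I.2 i).2) := by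
        refine Finset.sum_le_sum fun i hi => ?_
        exact hp.dist_le_mul _ (mem_image_of_mem _ (hI.1 i hi).1) _
          (mem_image_of_mem _ (hI.1 i hi).2)
    _ = K * ∑ i ∈ Finset.range I.1, dist (f (I.2 i).1) (f (I.2 i).2) := by
        rw [Finset.mul_sum]
    _ ≤ (K + 1) * ∑ i ∈ Finset.range I.1, dist (f (I.2 i).1) (f (I.2 i).2) := by
        have : 0 ≤ ∑ i ∈ Finset.range I.1, dist (f (I.2 i).1) (f (I.2 i).2) :=
          Finset.sum_nonneg fun i _ => dist_nonneg
        nlinarith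
    _ < (K + 1) * (ε / (K + 1)) := by gcongr
    _ = ε := by field_simp

theorem ac_exp_neg {f : ℝ → ℝ} {a b : ℝ} (hf : AbsolutelyContinuousOnInterval f a b) :
    AbsolutelyContinuousOnInterval (fun t => Real.exp (-f t)) a b := by
  obtain ⟨C, hC⟩ := hf.exists_bound
  have hd : ContDiffOn ℝ 1 (fun y : ℝ => Real.exp (-y)) (Icc (-C) C) := by fun_prop
  obtain ⟨K, hK⟩ := hd.exists_lipschitzOnWith (by decide) (convex_Icc _ _) isCompact_Icc
  refine ac_lip_comp (p := fun y : ℝ => Real.exp (-y)) (K := K) hf (hK.mono ?_)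
  rintro _ ⟨t, ht, rfl⟩
  exact abs_le.1 (hC t ht)

theorem core_ineq {a h X : ℝ → ℝ} {T b c : ℝ} (hT : 0 ≤ T)
    (ha : IntervalIntegrable a volume 0 T) (hX : IntervalIntegrable X volume 0 T)
    (hh : ∀ t ∈ Icc 0 T, h t - h 0 = ∫ s in (0:ℝ)..t, X s)
    (hi : ∀ t ∈ Icc 0 T, X t + c * h t ≤ b + a t * h t) :
    Real.exp (-∫ s in (0:ℝ)..T, a s) * h T
      + c * ∫ t in (0:ℝ)..T, Real.exp (-∫ s in (0:ℝ)..t, a s) * h t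
      ≤ h 0 + b * ∫ t in (0:ℝ)..T, Real.exp (-∫ s in (0:ℝ)..t, a s) := by
  have hA := ha.absolutelyContinuousOnInterval_intervalIntegral (c := 0) (by simp)
  have hw := ac_exp_neg hA
  have hk := hX.absolutelyContinuousOnInterval_intervalIntegral (c := 0) (by simp)
  set w : ℝ → ℝ := fun t => Real.exp (-∫ s in (0:ℝ)..t, a s) with hwdef
  have hk0 : AbsolutelyContinuousOnInterval (fun t : ℝ => h 0) 0 T :=
    (contDiffOn_const (𝕜 := ℝ) (n := 1)).absolutelyContinuousOnInterval
  have hkk := hk0.fun_add hk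
  have huI : uIcc 0 T = Icc 0 T := uIcc_of_le hT
  have hkh : ∀ t ∈ Icc 0 T, h 0 + ∫ s in (0:ℝ)..t, X s = h t := fun t ht => by
    rw [← hh t ht]; ring
  have hhc : ContinuousOn h (uIcc 0 T) := by
    refine hkk.continuousOn.congr fun t ht => ?_
    rw [huI] at ht
    exact (hkh t ht).symm
  have key := hw.integral_deriv_mul_eq_sub hkk
  have e0 : h 0 + ∫ s in (0:ℝ)..0, X s = h 0 := by simp
  have w0 : w 0 = 1 := by simp [hwdef]
  have hint : IntervalIntegrable (fun t => w t * (X t - a t * h t)) volume 0 T :=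
    (hX.sub (ha.mul_continuousOn hhc)).continuousOn_mul hw.continuousOn
  have key2 : ∫ t in (0:ℝ)..T, w t * (X t - a t * h t) = w T * h T - h 0 := by
    have : w T * h T - h 0 = w T * (h 0 + ∫ s in (0:ℝ)..T, X s)
        - w 0 * (h 0 + ∫ s in (0:ℝ)..0, X s) := by
      rw [e0, w0, hkh T ⟨hT, le_rfl⟩]; ring
    rw [this, ← key]
    apply intervalIntegral.integral_congr_ae
    filter_upwards [ha.ae_hasDerivAt_integral, hX.ae_hasDerivAt_integral] with t h1 h2 ht
    have ht' : t ∈ uIcc 0 T := uIoc_subset_uIcc ht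
    have d1 := (h1 ht' 0 (by simp)).neg.exp
    have d2 := (h2 ht' 0 (by simp)).const_add (h 0)
    have d1' : deriv w t = _ := d1.deriv
    have d2' : deriv (fun t => h 0 + ∫ s in (0:ℝ)..t, X s) t = _ := d2.deriv
    rw [d1', d2', hkh t (huI ▸ ht')]
    simp only [hwdef, Pi.neg_apply]
    ring
  have i1 : IntervalIntegrable (fun t => w t * h t) volume 0 T :=
    (hw.continuousOn.mul hhc).intervalIntegrable
  have i2 : IntervalIntegrable w volume 0 T := hw.continuousOn.intervalIntegrable
  have mono : ∫ t in (0:ℝ)..T, w t * (X t - a t * h t)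
      ≤ ∫ t in (0:ℝ)..T, (b * w t - c * (w t * h t)) := by
    refine intervalIntegral.integral_mono_on hT hint ((i2.const_mul b).sub (i1.const_mul c)) ?_
    intro t ht
    have hwp : 0 ≤ w t := (Real.exp_pos _).le
    nlinarith [hi t ht, mul_le_mul_of_nonneg_left (hi t ht) hwp]
  rw [intervalIntegral.integral_sub (i2.const_mul b) (i1.const_mul c),
    intervalIntegral.integral_const_mul, intervalIntegral.integral_const_mul, key2] at mono
  change w T * h T + c * ∫ t in (0:ℝ)..T, w t * h t ≤ h 0 + b * ∫ t in (0:ℝ)..T, w t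
  linarith

namespace PDMP

variable {n : ℕ} {U : Type*} [MeasurableSpace U]

theorem fs_down {S : Setting n U} {x : Fin n → ℝ} {s t : ℝ} (ht : t ∈ S.fs x) (hs : 0 ≤ s)
    (hst : s ≤ t) : s ∈ S.fs x :=
  ⟨hs, lt_of_le_of_lt (ENNReal.ofReal_le_ofReal hst) ht.2⟩

theorem mem_E_of_fs [TopologicalSpace U] {S : Setting n U} (hS : Basic S) {x : Fin n → ℝ}
    (hx : x ∈ S.E) {t : ℝ} (ht : t ∈ S.fs x) : S.φ x t ∈ S.E := by
  have hc : Continuous (S.φ x) := hS.contFlow.comp (by fun_prop : Continuous fun t => (x, t))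
  have hpre : IsPreconnected (S.φ x '' Icc 0 t) := isPreconnected_Icc.image _ hc.continuousOn
  have h0 : x ∈ S.φ x '' Icc 0 t := ⟨0, ⟨le_rfl, ht.1⟩, hS.flowZero x⟩
  refine hpre.subset_of_closure_inter_subset hS.openE ⟨x, h0, hx⟩ ?_ ⟨t, ⟨ht.1, le_rfl⟩, rfl⟩
  rintro _ ⟨hy, s, hs, rfl⟩
  by_contra hn
  have hf : S.φ x s ∈ frontier S.E := by
    rw [hS.openE.frontier_eq]; exact ⟨hy, hn⟩
  have hs0 : 0 < s := by
    rcases hs.1.eq_or_lt with h | h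
    · rw [← h, hS.flowZero] at hn; exact absurd hx hn
    · exact h
  have : S.ts x ≤ ENNReal.ofReal s := sInf_le ⟨s, hs0, hf, rfl⟩
  exact absurd (lt_of_le_of_lt (this.trans (ENNReal.ofReal_le_ofReal hs.2)) ht.2) (lt_irrefl _)

theorem ts_pos [TopologicalSpace U] {S : Setting n U} (hS : Basic S) {x : Fin n → ℝ}
    (hx : x ∈ S.E) : 0 < S.ts x := by
  have hc : Continuous (S.φ x) := hS.contFlow.comp (by fun_prop : Continuous fun t => (x, t))
  have hn : S.φ x ⁻¹' S.E ∈ 𝓝 (0 : ℝ) :=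
    (hS.openE.preimage hc).mem_nhds (by simpa [hS.flowZero] using hx)
  obtain ⟨ε, hε, hb⟩ := Metric.mem_nhds_iff.1 hn
  refine lt_of_lt_of_le (ENNReal.ofReal_pos.2 hε) (le_sInf ?_)
  rintro _ ⟨t, ht, hf, rfl⟩
  refine ENNReal.ofReal_le_ofReal ?_
  by_contra hlt
  have h1 : S.φ x t ∈ S.E := hb (by simp [abs_of_pos ht]; linarith)
  rw [hS.openE.frontier_eq] at hf
  exact hf.2 h1

theorem fs_of_lt {S : Setting n U} {x : Fin n → ℝ} (hT : S.ts x < ⊤) {t : ℝ} (ht : 0 ≤ t)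
    (h : t < S.tsR x) : t ∈ S.fs x :=
  ⟨ht, (ENNReal.ofReal_lt_iff_lt_toReal ht hT.ne).2 h⟩

theorem lintegral_fs_le {S : Setting n U} {x : Fin n → ℝ} (F : ℝ → ℝ≥0∞) (C : ℝ≥0∞)
    (h : ∀ t ∈ S.fs x, ∫⁻ s in Ioc 0 t, F s ≤ C) : ∫⁻ s in S.fs x, F s ≤ C := by
  let ι := {q : ℚ // (q : ℝ) ∈ S.fs x}
  have hsub : S.fs x ⊆ (⋃ i : ι, Ioc (0 : ℝ) (i.1 : ℝ)) ∪ {0} := by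
    intro t ht
    rcases ht.1.eq_or_lt with h0 | h0
    · right; exact h0.symm
    left
    obtain ⟨q, hq1, hq2⟩ : ∃ q : ℚ, t < (q : ℝ) ∧ ENNReal.ofReal q < S.ts x := by
      rcases eq_or_ne (S.ts x) ⊤ with h1 | h1
      · obtain ⟨q, hq⟩ := exists_rat_gt t
        exact ⟨q, hq, by rw [h1]; exact ENNReal.ofReal_lt_top⟩
      · have := (ENNReal.ofReal_lt_iff_lt_toReal ht.1 h1).1 ht.2
        obtain ⟨q, hq1, hq2⟩ := exists_rat_btwn this
        exact ⟨q, hq1, (ENNReal.ofReal_lt_iff_lt_toReal (ht.1.trans hq1.le) h1).2 hq2⟩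
    exact mem_iUnion.2 ⟨⟨q, ht.1.trans hq1.le, hq2⟩, h0, hq1.le⟩
  calc ∫⁻ s in S.fs x, F s ≤ ∫⁻ s in (⋃ i : ι, Ioc (0 : ℝ) (i.1 : ℝ)) ∪ {0}, F s :=
        lintegral_mono_set hsub
    _ ≤ (∫⁻ s in (⋃ i : ι, Ioc (0 : ℝ) (i.1 : ℝ)), F s) + ∫⁻ s in {0}, F s :=
        lintegral_union_le _ _ _
    _ = ⨆ i : ι, ∫⁻ s in Ioc (0 : ℝ) (i.1 : ℝ), F s := by
        rw [setLIntegral_iUnion_of_directed]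
        · simp
        · intro i j
          rcases le_total i.1 j.1 with hij | hij
          · exact ⟨j, Ioc_subset_Ioc_right (by exact_mod_cast hij), subset_rfl⟩
          · exact ⟨i, subset_rfl, Ioc_subset_Ioc_right (by exact_mod_cast hij)⟩
    _ ≤ C := iSup_le fun i => h _ i.2

end PDMP

theorem main_aux {n : ℕ} {U : Type*} [MeasurableSpace U] [MetricSpace U]
    [CompactSpace U] [BorelSpace U]
    (S : Setting n U) (hS : Basic S)
    (b c : ℝ) (g Xg rbar lamL : (Fin n → ℝ) → ℝ) (Kl : ℝ)
    (hEG : ExpGrowth S b c g Xg rbar)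
    (hLR : LowerRate S c lamL Kl)
    (u : (Fin n → ℝ) → U) (hu : S.IsSelector u) (x : Fin n → ℝ) (hx : x ∈ S.E) :
    ENNReal.ofReal c * S.Lop 0 (fun y _ => ENNReal.ofReal (g y)) x (S.feedback u x)
      + S.Hop 0 (fun y _ => ENNReal.ofReal (g y)) x (S.feedback u x)
        ≤ ENNReal.ofReal ((1 + b * Kl) * g x) := by
  have hc : Continuous (S.φ x) := hS.contFlow.comp (by fun_prop : Continuous fun t => (x, t))
  set a : ℝ → ℝ := fun s => S.lam (S.φ x s) (u (S.φ x s)) with ha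
  have ham : Measurable a :=
    hS.lamMeas.comp (hc.measurable.prodMk (hu.1.comp hc.measurable))
  have hcl : ∀ t ∈ S.fs x, S.φ x t ∈ closure S.E := fun t ht =>
    subset_closure (mem_E_of_fs hS hx ht)
  have hpos : ∀ t ∈ S.fs x, 0 ≤ a t := fun t ht => hS.lamNonneg _ (hcl t ht) _
  have hLam : ∀ t, S.Lam x (S.feedback u x) t = ∫⁻ s in Ioc 0 t, ENNReal.ofReal (a s) := by
    intro t
    simp only [Setting.Lam, Setting.lamMix, Setting.feedback, lintegral_dirac, ha]
  -- general consequence of nonnegativity and finiteness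
  have gen : ∀ t, 0 ≤ t → (∀ s ∈ Ioo 0 t, s ∈ S.fs x) →
      (∫⁻ s in Ioc (0 : ℝ) t, ⨆ a ∈ S.feas (S.φ x s), ENNReal.ofReal (S.lam (S.φ x s) a)) < ⊤ →
      IntervalIntegrable a volume 0 t ∧ ∀ β, S.weight β x (S.feedback u x) t
        = ENNReal.ofReal (Real.exp (-(β * t) - ∫ s in (0 : ℝ)..t, a s)) := by
    intro t ht hsub hfin
    have hae : ∀ᵐ s ∂(volume.restrict (Ioc (0 : ℝ) t)), s ∈ S.fs x := by
      rw [← restrict_Ioo_eq_restrict_Ioc]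
      filter_upwards [ae_restrict_mem measurableSet_Ioo] with s hs using hsub s hs
    have hnn : 0 ≤ᵐ[volume.restrict (Ioc (0 : ℝ) t)] a := by
      filter_upwards [hae] with s hs using hpos s hs
    have hlt : ∫⁻ s in Ioc (0 : ℝ) t, ENNReal.ofReal (a s) < ⊤ := by
      refine lt_of_le_of_lt (lintegral_mono_ae ?_) hfin
      filter_upwards [hae] with s hs
      exact le_iSup₂_of_le (u (S.φ x s)) (hu.2 _ (hcl s hs)) le_rfl
    have hI : Integrable a (volume.restrict (Ioc (0 : ℝ) t)) :=
      ⟨ham.aestronglyMeasurable, (hasFiniteIntegral_iff_ofReal hnn).2 hlt⟩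
    refine ⟨(intervalIntegrable_iff_integrableOn_Ioc_of_le ht).2 hI, fun β => ?_⟩
    rw [Setting.weight, hLam, if_neg hlt.ne, intervalIntegral.integral_of_le ht,
      integral_eq_lintegral_of_nonneg_ae hnn ham.aestronglyMeasurable]
  have hg1 := hEG.g_ge_one
  have hc0 := hEG.c_pos
  have hb0 := hEG.b_nonneg
  have hK0 := hLR.Kl_nonneg
  set w : ℝ → ℝ := fun t => Real.exp (-∫ s in (0 : ℝ)..t, a s) with hw
  have hwp : ∀ t, 0 < w t := fun t => Real.exp_pos _
  have genfs : ∀ t ∈ S.fs x, IntervalIntegrable a volume 0 t ∧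
      S.weight 0 x (S.feedback u x) t = ENNReal.ofReal (w t) := by
    intro t ht
    obtain ⟨h1, h2⟩ := gen t ht.1 (fun s hs => fs_down ht hs.1.le hs.2.le) (hLR.supInt x hx t ht)
    refine ⟨h1, ?_⟩
    rw [h2 0]
    simp [hw]
  have hwc : ∀ t, 0 ≤ t → IntervalIntegrable a volume 0 t → ContinuousOn w (Icc 0 t) := by
    intro t ht hI
    have := intervalIntegral.continuousOn_primitive_interval' hI left_mem_uIcc
    rw [uIcc_of_le ht] at this
    exact this.neg.rexp
  -- bound on the integral of the weight
  have hwK : ∀ t ∈ S.fs x, ∫ s in (0 : ℝ)..t, w s ≤ Kl := by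
    intro t ht
    rw [intervalIntegral.integral_of_le ht.1, ← ENNReal.ofReal_le_ofReal_iff hK0]
    have hI : IntegrableOn w (Ioc 0 t) := 
      ((hwc t ht.1 (genfs t ht).1).integrableOn_Icc).mono_set Ioc_subset_Icc_self
    rw [ofReal_integral_eq_lintegral_ofReal hI (Eventually.of_forall fun s => (hwp s).le)]
    refine le_trans ?_ (hLR.intBound x hx)
    refine le_trans ?_ (lintegral_mono_set (s := Ioc 0 t) fun s hs => fs_down ht hs.1.le hs.2)
    refine setLIntegral_mono' measurableSet_Ioc fun s hs => ENNReal.ofReal_le_ofReal ?_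
    refine Real.exp_le_exp.2 ?_
    have hsf := fs_down ht hs.1.le hs.2
    have : ∫ r in (0 : ℝ)..s, lamL (S.φ x r) ≤ ∫ r in (0 : ℝ)..s, a r := by
      refine intervalIntegral.integral_mono_on hs.1.le (hLR.lamL_locInt x hx s hsf)
        (genfs s hsf).1 fun r hr => ?_
      have hrf := fs_down hsf hr.1 hr.2
      exact hLR.lam_ge _ (mem_E_of_fs hS hx hrf) _ (hu.2 _ (hcl r hrf))
    have : 0 ≤ c * s := mul_nonneg hc0.le hs.1.le
    linarith
  set h : ℝ → ℝ := fun t => g (S.φ x t) with hh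
  have h0 : h 0 = g x := by simp [hh, hS.flowZero]
  have hhp : ∀ t, 0 ≤ h t := fun t => zero_le_one.trans (hg1 _)
  have hfsI : ∀ t ∈ S.fs x, IntervalIntegrable (fun s => w s * h s) volume 0 t := by
    intro t ht
    have hX := (hEG.g_mac.2.2.1 x hx t ht).1
    have hp := intervalIntegral.continuousOn_primitive_interval' hX left_mem_uIcc
    have hhc : ContinuousOn h (Icc 0 t) := by
      rw [uIcc_of_le ht.1] at hp
      refine (hp.const_add (g x)).congr fun s hs => ?_
      have := (hEG.g_mac.2.2.1 x hx s (fs_down ht hs.1 hs.2)).2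
      simp only [hh]
      linarith
    refine ContinuousOn.intervalIntegrable ?_
    rw [uIcc_of_le ht.1]
    exact (hwc t ht.1 (genfs t ht).1).mul hhc
  have main : ∀ t ∈ S.fs x, w t * h t + c * ∫ s in (0 : ℝ)..t, w s * h s
      ≤ (1 + b * Kl) * g x := by
    intro t ht
    have hX := (hEG.g_mac.2.2.1 x hx t ht).1
    have := core_ineq (h := h) (b := b) (c := c) ht.1 (genfs t ht).1 hX
      (fun s hs => by
        rw [h0]; exact (hEG.g_mac.2.2.1 x hx s (fs_down ht hs.1 hs.2)).2)
      (fun s hs => by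
        have hsf := fs_down ht hs.1 hs.2
        have hd := hEG.drift _ (mem_E_of_fs hS hx hsf) _ (hu.2 _ (hcl s hsf))
        exact EReal.coe_le_coe_iff.1 (le_trans (le_add_of_nonneg_right
          (EReal.coe_ennreal_nonneg _)) hd))
    have h2 : b * ∫ s in (0 : ℝ)..t, w s ≤ b * Kl * g x := by
      have h3 := mul_le_mul_of_nonneg_left (hwK t ht) hb0
      have h4 := mul_le_mul_of_nonneg_left (hg1 x) (mul_nonneg hb0 hK0)
      linarith
    rw [h0] at this
    change w t * h t + c * ∫ s in (0 : ℝ)..t, w s * h s ≤ g x + b * ∫ s in (0 : ℝ)..t, w s at this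
    linarith
  -- monotonicity of the partial integrals
  have hmono : ∀ s t, t ∈ S.fs x → 0 ≤ s → s ≤ t →
      ∫ r in (0 : ℝ)..s, w r * h r ≤ ∫ r in (0 : ℝ)..t, w r * h r := by
    intro s t ht hs hst
    refine intervalIntegral.integral_mono_interval le_rfl hs hst ?_ (hfsI t ht)
    exact Eventually.of_forall fun r => mul_nonneg (hwp r).le (hhp r)
  have conv : ∀ B : ℝ, 0 ≤ B → 
      (∀ s ∈ S.fs x, B + c * ∫ r in (0 : ℝ)..s, w r * h r ≤ (1 + b * Kl) * g x) →
      ENNReal.ofReal c * S.Lop 0 (fun y _ => ENNReal.ofReal (g y)) x (S.feedback u x)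
        + ENNReal.ofReal B ≤ ENNReal.ofReal ((1 + b * Kl) * g x) := by
    intro B hB hs
    have hCB : 0 ≤ (1 + b * Kl) * g x - B := by
      have := hs 0 ⟨le_rfl, by simpa using ts_pos hS hx⟩
      simp at this
      linarith
    have : ENNReal.ofReal c * S.Lop 0 (fun y _ => ENNReal.ofReal (g y)) x (S.feedback u x)
        ≤ ENNReal.ofReal ((1 + b * Kl) * g x - B) := by
      have hle : S.Lop 0 (fun y _ => ENNReal.ofReal (g y)) x (S.feedback u x)
          ≤ ENNReal.ofReal (((1 + b * Kl) * g x - B) / c) := by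
        refine lintegral_fs_le _ _ fun t ht => ?_
        have hI := (intervalIntegrable_iff_integrableOn_Ioc_of_le ht.1).1 (hfsI t ht)
        have e : ∫⁻ s in Ioc 0 t, S.weight 0 x (S.feedback u x) s * ENNReal.ofReal (g (S.φ x s))
            = ENNReal.ofReal (∫ s in (0 : ℝ)..t, w s * h s) := by
          rw [intervalIntegral.integral_of_le ht.1, ofReal_integral_eq_lintegral_ofReal hI
            (Eventually.of_forall fun r => mul_nonneg (hwp r).le (hhp r))]
          refine setLIntegral_congr_fun measurableSet_Ioc fun s hs => ?_
          rw [(genfs s (fs_down ht hs.1.le hs.2)).2, ENNReal.ofReal_mul (hwp s).le]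
        rw [e]
        refine ENNReal.ofReal_le_ofReal ?_
        rw [le_div_iff₀ hc0]
        linarith [hs t ht]
      calc _ ≤ ENNReal.ofReal c * ENNReal.ofReal (((1 + b * Kl) * g x - B) / c) := by gcongr
        _ = _ := by rw [← ENNReal.ofReal_mul hc0.le]; congr 1; field_simp
    calc _ ≤ ENNReal.ofReal ((1 + b * Kl) * g x - B) + ENNReal.ofReal B := by gcongr
      _ = _ := by rw [← ENNReal.ofReal_add hCB hB]; congr 1; ring
  rw [Setting.Hop]
  split_ifs with hT
  · have hTp : 0 < S.tsR x := ENNReal.toReal_pos (ts_pos hS hx).ne' hT.ne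
    obtain ⟨hIT, hwT⟩ := gen (S.tsR x) hTp.le (fun s hs => fs_of_lt hT hs.1.le hs.2)
      (hLR.supIntTs x hx hT)
    have hwT' : S.weight 0 x (S.feedback u x) (S.tsR x) = ENNReal.ofReal (w (S.tsR x)) := by
      rw [hwT 0]; simp [hw]
    rw [hwT', ← ENNReal.ofReal_mul (hwp _).le]
    refine conv _ (mul_nonneg (hwp _).le (hhp _)) fun s hs => ?_
    have hsT : s < S.tsR x := (ENNReal.ofReal_lt_iff_lt_toReal hs.1 hT.ne).1 hs.2
    have l1 : Tendsto w (𝓝[<] S.tsR x) (𝓝 (w (S.tsR x))) := by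
      have := (hwc _ hTp.le hIT) (S.tsR x) ⟨hTp.le, le_rfl⟩
      refine this.mono_left ?_
      rw [← nhdsWithin_Ioo_eq_nhdsLT hTp]
      exact nhdsWithin_mono _ Ioo_subset_Icc_self
    have l2 := hEG.g_mac.2.2.2 x hx hT
    have l3 := (l1.mul l2).add_const (c * ∫ r in (0 : ℝ)..s, w r * h r)
    refine le_of_tendsto l3 ?_
    filter_upwards [Ioo_mem_nhdsLT hsT] with t ht
    have htf : t ∈ S.fs x := fs_of_lt hT (hs.1.trans ht.1.le) ht.2
    have m1 := main t htf
    have m2 := mul_le_mul_of_nonneg_left (hmono s t htf hs.1 ht.1.le) hc0.le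
    change w t * h t + _ ≤ _
    linarith
  · have := conv 0 le_rfl fun s hs => by
      have := main s hs
      have := mul_nonneg (hwp s).le (hhp s)
      linarith
    simpa using this

/-- Theorem 3.4(ii) of the paper: under the full expected growth and lower-rate conditions, for
every ordinary feedback selector `u` and every `x ∈ E`,
`L f(x,u_φ(x)) + H r(x,u_φ(x)) ≤ (M(1+bK_λ)/c)·g(x)` and
`L g(x,u_φ(x)) ≤ ((1+bK_λ)/c)·g(x)` (undiscounted operators, `α = 0`). -/
theorem theorem_3_4_ii {n : ℕ} {U : Type*} [MeasurableSpace U] [MetricSpace U]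
    [CompactSpace U] [BorelSpace U]
    (S : Setting n U) (hS : Basic S)
    (b c δ M : ℝ) (g Xg rbar lamL : (Fin n → ℝ) → ℝ) (Kl : ℝ)
    (f r : (Fin n → ℝ) → U → ℝ)
    (hEG : ExpGrowth S b c g Xg rbar) (hCB : CostBound S c δ M g rbar f r)
    (hLR : LowerRate S c lamL Kl)
    (u : (Fin n → ℝ) → U) (hu : S.IsSelector u) (x : Fin n → ℝ) (hx : x ∈ S.E) :
    S.Lop 0 (S.mix f) x (S.feedback u x) + S.Hop 0 (S.mix r) x (S.feedback u x)
        ≤ ENNReal.ofReal (M * (1 + b * Kl) / c * g x) ∧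
      S.Lop 0 (fun y _ => ENNReal.ofReal (g y)) x (S.feedback u x)
        ≤ ENNReal.ofReal ((1 + b * Kl) / c * g x) := by
  have hmain := main_aux S hS b c g Xg rbar lamL Kl hEG hLR u hu x hx
  have hc0 := hEG.c_pos
  have hM := hCB.M_nonneg
  have hg0 : ∀ y, 0 ≤ g y := fun y => zero_le_one.trans (hEG.g_ge_one y)
  have hcc : ENNReal.ofReal (1 / c) * ENNReal.ofReal c = 1 := by
    rw [← ENNReal.ofReal_mul (by positivity), one_div_mul_cancel hc0.ne', ENNReal.ofReal_one]
  have hmain2 : S.Lop 0 (fun y _ => ENNReal.ofReal (g y)) x (S.feedback u x)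
      + ENNReal.ofReal (1 / c) * S.Hop 0 (fun y _ => ENNReal.ofReal (g y)) x (S.feedback u x)
        ≤ ENNReal.ofReal ((1 + b * Kl) / c * g x) := by
    calc _ = ENNReal.ofReal (1 / c) *
          (ENNReal.ofReal c * S.Lop 0 (fun y _ => ENNReal.ofReal (g y)) x (S.feedback u x)
            + S.Hop 0 (fun y _ => ENNReal.ofReal (g y)) x (S.feedback u x)) := by
          rw [mul_add, ← mul_assoc, hcc, one_mul]
      _ ≤ ENNReal.ofReal (1 / c) * ENNReal.ofReal ((1 + b * Kl) * g x) := by gcongr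
      _ = _ := by
          rw [← ENNReal.ofReal_mul (by positivity)]; congr 1; ring
  refine ⟨?_, le_trans le_self_add hmain2⟩
  have hfsm : MeasurableSet (S.fs x) := by
    have : S.fs x = Ici 0 ∩ ENNReal.ofReal ⁻¹' (Iio (S.ts x)) := rfl
    rw [this]
    exact measurableSet_Ici.inter (ENNReal.measurable_ofReal measurableSet_Iio)
  have hL : S.Lop 0 (S.mix f) x (S.feedback u x) ≤ ENNReal.ofReal M *
      S.Lop 0 (fun y _ => ENNReal.ofReal (g y)) x (S.feedback u x) := by
    rw [Setting.Lop, Setting.Lop, ← lintegral_const_mul' _ _ ENNReal.ofReal_ne_top]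
    refine setLIntegral_mono' hfsm fun t ht => ?_
    have hE := mem_E_of_fs hS hx ht
    simp only [Setting.mix, Setting.feedback, lintegral_dirac]
    rw [mul_left_comm, ← ENNReal.ofReal_mul hM]
    gcongr
    exact hCB.f_bound _ hE _ (hu.2 _ (subset_closure hE))
  have hH : S.Hop 0 (S.mix r) x (S.feedback u x) ≤ ENNReal.ofReal M * (ENNReal.ofReal (1 / c) *
      S.Hop 0 (fun y _ => ENNReal.ofReal (g y)) x (S.feedback u x)) := by
    rw [Setting.Hop, Setting.Hop]
    split_ifs with hT
    · have hTp : 0 < S.tsR x := ENNReal.toReal_pos (ts_pos hS hx).ne' hT.ne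
      have hcl : S.φ x (S.tsR x) ∈ closure S.E := by
        have hc : Continuous (S.φ x) :=
          hS.contFlow.comp (by fun_prop : Continuous fun t => (x, t))
        refine mem_closure_of_tendsto
          (hc.continuousAt.tendsto.mono_left (nhdsWithin_le_nhds (s := Iio (S.tsR x)))) ?_
        filter_upwards [Ioo_mem_nhdsLT hTp] with t ht
        exact mem_E_of_fs hS hx (fs_of_lt hT ht.1.le ht.2)
      have hf := hu.2 _ hcl
      have hr := hCB.r_bound x hx hT _ hf
      have hb : rbar (S.φ x (S.tsR x)) ≤ g (S.φ x (S.tsR x)) :=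
        (ENNReal.ofReal_le_ofReal_iff (hg0 _)).1
          (le_trans le_self_add (hEG.bdryGrowth x hx hT _ hf))
      have hδ := hCB.δ_pos
      have hfin : r (S.φ x (S.tsR x)) (u (S.φ x (S.tsR x)))
          ≤ M * (1 / c * g (S.φ x (S.tsR x))) := by
        calc _ ≤ M / (c + δ) * rbar (S.φ x (S.tsR x)) := hr
          _ ≤ M / (c + δ) * g (S.φ x (S.tsR x)) := by gcongr
          _ ≤ M / c * g (S.φ x (S.tsR x)) := by
              gcongr
              · exact hg0 _
              · linarith
          _ = _ := by ring
      simp only [Setting.mix]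
      have e : ∫⁻ v, ENNReal.ofReal (r (S.φ x (S.tsR x)) v) ∂(S.feedback u x).bdry
          = ENNReal.ofReal (r (S.φ x (S.tsR x)) (u (S.φ x (S.tsR x)))) := by
        simp only [Setting.feedback, lintegral_dirac]
      rw [e, mul_left_comm (ENNReal.ofReal (1 / c)), mul_left_comm (ENNReal.ofReal M),
        ← ENNReal.ofReal_mul (by positivity : 0 ≤ 1 / c), ← ENNReal.ofReal_mul hM]
      gcongr
    · exact zero_le
  calc _ ≤ ENNReal.ofReal M *
        (S.Lop 0 (fun y _ => ENNReal.ofReal (g y)) x (S.feedback u x)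
      + ENNReal.ofReal (1 / c) * S.Hop 0 (fun y _ => ENNReal.ofReal (g y)) x (S.feedback u x)) := by
        rw [mul_add]; exact add_le_add hL hH
    _ ≤ ENNReal.ofReal M * ENNReal.ofReal ((1 + b * Kl) / c * g x) := by gcongr
    _ = _ := by rw [← ENNReal.ofReal_mul hM]; congr 1; ring
end
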